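/- Let (S_k)_{k≥1} be a sequence of n×n row-stochastic matrices and v ∈ ℝⁿ such that S_k S_{k−1}⋯S_1 v → 0 as k → ∞. Then the series Σ_{j=1}^{∞} P (S_j Q)(S_{j−1} Q)⋯(S_1 Q) v converges in ℝⁿ with sum −P v, and moreover lim_{ρ → 1⁻} Σ_{j=1}^{∞} ρ^j · P (S_j Q)(S_{j−1} Q)⋯(S_1 Q) v = −P v (each series Σ_j ρ^j P(S_jQ)⋯(S_1Q)v with 0 < ρ < 1 being absolutely convergent). -/

import Mathlib

open Matrix Filter Topology

/-- `S` is a row-stochastic matrix: all entries in `[0,1]` and each row sums to `1`. -/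
def IsStochastic {n : ℕ} (S : Matrix (Fin n) (Fin n) ℝ) : Prop :=
  (∀ i j, 0 ≤ S i j ∧ S i j ≤ 1) ∧ ∀ i, ∑ j, S i j = 1

/-- The unit vector `u = (1/√n, …, 1/√n)`. -/
noncomputable def uvec (n : ℕ) : Fin n → ℝ := fun _ => 1 / Real.sqrt n

/-- The orthogonal projection onto the line `ℝu`, i.e. `(1/n)·J` with `J` the all-ones matrix. -/
noncomputable def Pmat (n : ℕ) : Matrix (Fin n) (Fin n) ℝ := Matrix.of fun _ _ => (1 : ℝ) / n

/-- The orthogonal projection `Q = I − P` onto the hyperplane `N = {v : ∑ᵢ vᵢ = 0}`. -/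
noncomputable def Qmat (n : ℕ) : Matrix (Fin n) (Fin n) ℝ := 1 - Pmat n

/-- `ℝⁿ` with the Euclidean norm. -/
noncomputable def toE {n : ℕ} (v : Fin n → ℝ) : EuclideanSpace ℝ (Fin n) :=
  (EuclideanSpace.equiv (Fin n) ℝ).symm v

/-- The operator norm of a matrix induced by the Euclidean norm on `ℝⁿ`. -/
noncomputable def opNorm {n : ℕ} (S : Matrix (Fin n) (Fin n) ℝ) : ℝ :=
  ‖LinearMap.toContinuousLinearMap (Matrix.toEuclideanLin S)‖

/-- The hyperplane `N = {v ∈ ℝⁿ : ∑ᵢ vᵢ = 0}`. -/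
noncomputable def Nhyp (n : ℕ) : Submodule ℝ (Fin n → ℝ) :=
  LinearMap.ker (∑ i : Fin n, (LinearMap.proj i : (Fin n → ℝ) →ₗ[ℝ] ℝ))

/-- Logarithm with values in `EReal`, with the convention `log 0 = −∞`. -/
noncomputable def elog (r : ℝ) : EReal := if r ≤ 0 then ⊥ else ((Real.log r : ℝ) : EReal)

/-- The cocycle iterates `S^k_x = S_{f^{k−1}(x)} ⋯ S_{f(x)} S_x`. -/
noncomputable def cocycle {n : ℕ} {X : Type*} (f : X → X) (S : X → Matrix (Fin n) (Fin n) ℝ) :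
    ℕ → X → Matrix (Fin n) (Fin n) ℝ
  | 0, _ => 1
  | k + 1, x => S (f^[k] x) * cocycle f S k x

/-- The ordered product `prodA S k = S_{k−1} ⋯ S_1 S_0`. -/
noncomputable def prodA {n : ℕ} (S : ℕ → Matrix (Fin n) (Fin n) ℝ) :
    ℕ → Matrix (Fin n) (Fin n) ℝ
  | 0 => 1
  | k + 1 => S k * prodA S k

theorem IsStochastic.mul_Pmat {n : ℕ} {S : Matrix (Fin n) (Fin n) ℝ} (hS : IsStochastic S) :
    S * Pmat n = Pmat n := by
  ext i j
  simp [Matrix.mul_apply, Pmat, ← Finset.sum_mul, hS.2 i]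

theorem Pmat_mul_self (n : ℕ) : Pmat n * Pmat n = Pmat n := by
  ext i j
  have hn : (n : ℝ) ≠ 0 := by
    have := i.pos
    positivity
  simp [Matrix.mul_apply, Pmat, hn]

theorem prodA_eq_add_sum {n : ℕ} {S : ℕ → Matrix (Fin n) (Fin n) ℝ}
    (hS : ∀ i, IsStochastic (S i)) (m : ℕ) :
    prodA S m = prodA (fun i => S i * Qmat n) m +
      ∑ j ∈ Finset.range m, Pmat n * prodA (fun i => S i * Qmat n) j := by
  induction m with
  | zero => simp [prodA]
  | succ m ih =>
    have hSQ : S m * Qmat n = S m - Pmat n := by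
      rw [Qmat, mul_sub, mul_one, (hS m).mul_Pmat]
    rw [prodA, ih, mul_add, Finset.mul_sum, Finset.sum_range_succ, prodA, hSQ, sub_mul]
    simp only [← mul_assoc, (hS m).mul_Pmat]
    abel

theorem sum_Pmat_mul_prodA {n : ℕ} {S : ℕ → Matrix (Fin n) (Fin n) ℝ}
    (hS : ∀ i, IsStochastic (S i)) (m : ℕ) :
    ∑ j ∈ Finset.range m, Pmat n * prodA (fun i => S i * Qmat n) (j + 1) =
      Pmat n * prodA S m - Pmat n := by
  have h := congrArg (Pmat n * ·) (prodA_eq_add_sum hS m)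
  simp only [mul_add, Finset.mul_sum, ← mul_assoc, Pmat_mul_self] at h
  have h' := Finset.sum_range_succ' (fun j => Pmat n * prodA (fun i => S i * Qmat n) j) m
  rw [Finset.sum_range_succ] at h'
  simp only [prodA, mul_one] at h' ⊢
  rw [h, add_comm, h', add_sub_cancel_right]

/-- If the partial sums of a sequence in a normed space converge, then the associated power
series converges absolutely on the open unit interval. -/
theorem summable_norm_pow_smul_of_tendsto_sum {E : Type*} [NormedAddCommGroup E]
    [NormedSpace ℝ E] {f : ℕ → E} {a : E}
    (hf : Tendsto (fun m => ∑ j ∈ Finset.range m, f j) atTop (𝓝 a))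
    {ρ : ℝ} (hρ : ρ ∈ Set.Ioo (0 : ℝ) 1) :
    Summable fun j => ‖ρ ^ (j + 1) • f j‖ := by
  have hf0 : Tendsto f atTop (𝓝 0) := by
    have h := (hf.comp (tendsto_add_atTop_nat 1)).sub hf
    simpa [Function.comp_def, Finset.sum_range_succ] using h
  obtain ⟨C, hC⟩ := (Metric.isBounded_range_of_tendsto f hf0).exists_norm_le
  refine Summable.of_nonneg_of_le (fun _ => norm_nonneg _) (fun j => ?_)
    (((summable_geometric_of_lt_one hρ.1.le hρ.2).mul_left ρ).mul_right C)
  rw [norm_smul, Real.norm_of_nonneg (pow_nonneg hρ.1.le _), pow_succ']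
  exact mul_le_mul_of_nonneg_left (hC _ ⟨j, rfl⟩)
    (mul_nonneg hρ.1.le (pow_nonneg hρ.1.le _))

/-- **Abel's limit theorem** for series in a finite power of `ℝ`. -/
theorem tendsto_tsum_pow_smul_of_tendsto_sum {ι : Type*} [Fintype ι] {f : ℕ → ι → ℝ} {a : ι → ℝ}
    (hf : Tendsto (fun m => ∑ j ∈ Finset.range m, f j) atTop (𝓝 a)) :
    Tendsto (fun ρ : ℝ => ∑' j : ℕ, ρ ^ (j + 1) • f j) (𝓝[Set.Ioo 0 1] 1) (𝓝 a) := by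
  rw [tendsto_pi_nhds]
  intro i
  have hfi : Tendsto (fun m => ∑ j ∈ Finset.range m, f j i) atTop (𝓝 (a i)) := by
    simpa using tendsto_pi_nhds.1 hf i
  have hid : Tendsto (fun ρ : ℝ => ρ) (𝓝[Set.Ioo 0 1] 1) (𝓝 1) :=
    tendsto_id.mono_left nhdsWithin_le_nhds
  have habel := hid.mul ((Real.tendsto_tsum_powerSeries_nhdsWithin_lt hfi).mono_left
    (nhdsWithin_mono 1 fun _ hx => hx.2))
  rw [one_mul] at habel
  refine habel.congr' ?_
  filter_upwards [self_mem_nhdsWithin] with ρ hρ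
  rw [tsum_apply (summable_norm_pow_smul_of_tendsto_sum hf hρ).of_norm, ← tsum_mul_left]
  refine tsum_congr fun j => ?_
  simp only [Pi.smul_apply, smul_eq_mul]
  ring

/-- If `(S_k)_{k≥1}` are stochastic (here `S j` with `S 0 = S_1`) and
`S_k⋯S_1 v → 0`, then `∑_{j≥1} P (S_j Q)⋯(S_1 Q) v` converges to `−Pv`; each series
`∑_{j≥1} ρ^j P (S_j Q)⋯(S_1 Q) v` with `0 < ρ < 1` is absolutely convergent; and
`lim_{ρ→1⁻} ∑_{j≥1} ρ^j P (S_j Q)⋯(S_1 Q) v = −Pv`. -/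
theorem stmt8 {n : ℕ} (S : ℕ → Matrix (Fin n) (Fin n) ℝ) (hS : ∀ i, IsStochastic (S i))
    (v : Fin n → ℝ)
    (hv : Tendsto (fun k => (prodA S k).mulVec v) atTop (nhds 0)) :
    Tendsto (fun m => ∑ j ∈ Finset.range m,
        (Pmat n * prodA (fun i => S i * Qmat n) (j + 1)).mulVec v) atTop
      (nhds (-(Pmat n).mulVec v)) ∧
    (∀ ρ : ℝ, ρ ∈ Set.Ioo (0:ℝ) 1 →
      Summable (fun j : ℕ => ‖toE (ρ ^ (j + 1) •
        (Pmat n * prodA (fun i => S i * Qmat n) (j + 1)).mulVec v)‖)) ∧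
    Tendsto (fun ρ : ℝ => ∑' j : ℕ, ρ ^ (j + 1) •
        (Pmat n * prodA (fun i => S i * Qmat n) (j + 1)).mulVec v)
      (nhdsWithin 1 (Set.Ioo 0 1)) (nhds (-(Pmat n).mulVec v)) := by
  have hsum : Tendsto (fun m => ∑ j ∈ Finset.range m,
      (Pmat n * prodA (fun i => S i * Qmat n) (j + 1)).mulVec v) atTop
      (𝓝 (-(Pmat n).mulVec v)) := by
    have hcont : Continuous fun w : Fin n → ℝ => (Pmat n).mulVec w - (Pmat n).mulVec v := by
      fun_prop
    have h := (hcont.tendsto 0).comp hv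
    simp only [Matrix.mulVec_zero, zero_sub] at h
    refine h.congr fun m => ?_
    rw [Function.comp_apply, ← Matrix.sum_mulVec, sum_Pmat_mul_prodA hS, Matrix.sub_mulVec,
      Matrix.mulVec_mulVec]
  refine ⟨hsum, fun ρ hρ => ?_, tendsto_tsum_pow_smul_of_tendsto_sum hsum⟩
  have hE := ((EuclideanSpace.equiv (Fin n) ℝ).symm.continuous.tendsto _).comp hsum
  simp only [Function.comp_def, map_sum] at hE
  simpa only [toE, map_smul] using summable_norm_pow_smul_of_tendsto_sum hE hρ
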